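/- There exists ε₀ ∈ (0,1) such that for every ε ∈ (0,ε₀) and every wavenumber k with √(1−ε) < k < √(1+ε), there exists a smooth function u_p : ℝ → ℝ which is 2π-periodic, even, satisfies u_p(0) > 0, sup_{ξ∈ℝ} |u_p(ξ)| ≤ 2ε, satisfies the antiperiodicity relation u_p(ξ+π) = −u_p(ξ) for all ξ ∈ ℝ, and solves the rescaled stationary one-dimensional Swift–Hohenberg equation −(1 + k²∂_ξ²)² u_p + ε² u_p − u_p³ = 0 on ℝ; moreover u_p is the unique such function, i.e. unique among 2π-periodic even C⁴ functions w with w(0) > 0 and sup |w| ≤ 2ε solving this equation. -/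

import Mathlib

open Real

/-- The rescaled stationary one-dimensional Swift–Hohenberg equation
`-(1 + k²∂_ξ²)² u + ε² u − u³ = 0`, written out as
`-(u + 2k²u'' + k⁴u'''') + ε²u − u³ = 0`. -/
def SwiftHohenberg1D (ε k : ℝ) (u : ℝ → ℝ) : Prop :=
  ∀ ξ : ℝ,
    -(u ξ + 2 * k ^ 2 * iteratedDeriv 2 u ξ + k ^ 4 * iteratedDeriv 4 u ξ)
      + ε ^ 2 * u ξ - u ξ ^ 3 = 0

/-- Cosine Fourier coefficient. -/
noncomputable def cf (n : ℕ) (f : ℝ → ℝ) : ℝ := (1 / π) * ∫ x in (-π)..π, f x * cos (n * x)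

lemma cf_bound (n : ℕ) (f : ℝ → ℝ) (B : ℝ) (h : ∀ x ∈ Set.Icc (-π) π, |f x| ≤ B) :
    |cf n f| ≤ 2 * B := by
  have h1 : ‖∫ x in (-π)..π, f x * cos (n * x)‖ ≤ B * |π - (-π)| := by
    apply intervalIntegral.norm_integral_le_of_norm_le_const
    intro x hx
    rw [Set.uIoc_of_le (by linarith [pi_pos])] at hx
    have := h x ⟨hx.1.le, hx.2⟩
    rw [norm_mul, Real.norm_eq_abs, Real.norm_eq_abs]
    have h2 := abs_cos_le_one (n * x)
    nlinarith [abs_nonneg (f x), abs_nonneg (cos (n * x))]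
  rw [Real.norm_eq_abs, show π - (-π) = 2 * π by ring, abs_of_pos (a := 2 * π) (by positivity)] at h1
  unfold cf
  rw [abs_mul, abs_of_pos (by positivity)]
  calc 1 / π * _ ≤ 1 / π * (B * (2 * π)) := by gcongr
    _ = 2 * B := by field_simp

lemma cf_add (n : ℕ) (f g : ℝ → ℝ) (hf : Continuous f) (hg : Continuous g) :
    cf n (fun x => f x + g x) = cf n f + cf n g := by
  unfold cf
  rw [← mul_add, ← intervalIntegral.integral_add]
  · congr 2; ext x; ring
  · exact (by fun_prop : Continuous fun x => f x * cos (n * x)).intervalIntegrable _ _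
  · exact (by fun_prop : Continuous fun x => g x * cos (n * x)).intervalIntegrable _ _

lemma cf_smul (n : ℕ) (a : ℝ) (f : ℝ → ℝ) :
    cf n (fun x => a * f x) = a * cf n f := by
  unfold cf
  rw [mul_left_comm, ← intervalIntegral.integral_const_mul (r := a)]
  congr 1
  apply intervalIntegral.integral_congr
  intro x _
  simp only []
  ring

lemma cf_cos3 : cf 1 (fun x => cos x ^ 3) = 3 / 4 := by
  unfold cf
  have : ∀ x : ℝ, cos x ^ 3 * cos ((1 : ℕ) * x) = cos x ^ 4 := by intro x; simp; ring
  simp_rw [this]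
  rw [show (4 : ℕ) = 2 + 2 from rfl, integral_cos_pow]
  simp [integral_cos_sq]
  field_simp
  norm_num

lemma periodic_deriv (f : ℝ → ℝ) (T : ℝ) (hf : Function.Periodic f T) :
    Function.Periodic (deriv f) T := by
  intro x
  have : deriv (fun y => f (y + T)) x = deriv f (x + T) := deriv_comp_add_const f T x
  rw [← this]
  congr 1; ext y; exact hf y

lemma cf_deriv2 (n : ℕ) (f : ℝ → ℝ) (hf : ContDiff ℝ 2 f) (hp : Function.Periodic f (2 * π)) :
    cf n (deriv (deriv f)) = - (n : ℝ) ^ 2 * cf n f := by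
  have hd1 : Differentiable ℝ f := hf.differentiable (by norm_num)
  have hf1 : ContDiff ℝ 1 (deriv f) := ContDiff.deriv' (n := 1) (hf.of_le (by norm_num))
  have hd2 : Differentiable ℝ (deriv f) := hf1.differentiable (by norm_num)
  have hc2 : Continuous (deriv (deriv f)) := hf1.continuous_deriv (by norm_num)
  have e1 := hp (-π)
  have e2 := periodic_deriv f _ hp (-π)
  rw [show -π + 2 * π = π by ring] at e1 e2
  have dc : ∀ x : ℝ, HasDerivAt (fun x : ℝ => cos (n * x)) (-(n * sin (n * x))) x := by
    intro x
    have := ((hasDerivAt_id' x).const_mul (n : ℝ)).cos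
    convert this using 1
    ring
  have ds : ∀ x : ℝ, HasDerivAt (fun x : ℝ => sin (n * x)) (n * cos (n * x)) x := by
    intro x
    have := ((hasDerivAt_id' x).const_mul (n : ℝ)).sin
    convert this using 1
    ring
  have i1 := intervalIntegral.integral_deriv_mul_eq_sub (a := -π) (b := π)
    (u := deriv f) (v := fun x : ℝ => cos (n * x)) (u' := deriv (deriv f))
    (v' := fun x => -(n * sin (n * x))) (fun x _ => (hd2 x).hasDerivAt) (fun x _ => dc x)
    (hc2.intervalIntegrable _ _) (by apply Continuous.intervalIntegrable; fun_prop)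
  have i2 := intervalIntegral.integral_deriv_mul_eq_sub (a := -π) (b := π)
    (u := f) (v := fun x : ℝ => sin (n * x)) (u' := deriv f)
    (v' := fun x => (n * cos (n * x))) (fun x _ => (hd1 x).hasDerivAt) (fun x _ => ds x)
    (hd2.continuous.intervalIntegrable _ _) (by apply Continuous.intervalIntegrable; fun_prop)
  have hdc := hd2.continuous
  have hcf := hd1.continuous
  rw [intervalIntegral.integral_add (by apply Continuous.intervalIntegrable; fun_prop)
    (by apply Continuous.intervalIntegrable; fun_prop)] at i1 i2
  have j1 : ∫ x in (-π)..π, deriv f x * -(n * sin (n * x))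
      = - n * ∫ x in (-π)..π, deriv f x * sin (n * x) := by
    rw [← intervalIntegral.integral_const_mul]; congr 1; ext x; ring
  have j2 : ∫ x in (-π)..π, f x * (n * cos (n * x))
      = n * ∫ x in (-π)..π, f x * cos (n * x) := by
    rw [← intervalIntegral.integral_const_mul]; congr 1; ext x; ring
  rw [j1] at i1
  rw [j2] at i2
  simp only [mul_neg, cos_neg, sin_neg, sin_nat_mul_pi, mul_zero, neg_zero, sub_zero, e2] at i1 i2
  unfold cf
  linear_combination (1 / π) * i1 + (1 / π) * n * i2

lemma cf_decay (j : ℕ) : ∀ (f : ℝ → ℝ), ContDiff ℝ ((2 * j : ℕ) : WithTop ℕ∞) f →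
    Function.Periodic f (2 * π) → ∃ K, ∀ n : ℕ, |cf n f| * ((n : ℝ) + 1) ^ (2 * j) ≤ K := by
  induction j with
  | zero =>
    intro f hf _
    obtain ⟨B, hB⟩ := (isCompact_Icc (a := -π) (b := π)).exists_bound_of_continuousOn
      hf.continuous.continuousOn
    refine ⟨2 * B, fun n => ?_⟩
    simpa using cf_bound n f B hB
  | succ j ih =>
    intro f hf hp
    have hf2 : ContDiff ℝ 2 f := hf.of_le (by
      have : (2 : ℕ) ≤ 2 * (j + 1) := by omega
      exact_mod_cast this)
    have hf' : ContDiff ℝ ((2 * j + 1 : ℕ) : WithTop ℕ∞) (deriv f) :=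
      ContDiff.deriv' (by exact_mod_cast hf)
    have hf'' : ContDiff ℝ ((2 * j : ℕ) : WithTop ℕ∞) (deriv (deriv f)) :=
      ContDiff.deriv' (by exact_mod_cast hf')
    obtain ⟨K1, h1⟩ := ih f (hf.of_le (by
      have : 2 * j ≤ 2 * (j + 1) := by omega
      exact_mod_cast this)) hp
    obtain ⟨K2, h2⟩ := ih _ hf'' (periodic_deriv _ _ (periodic_deriv _ _ hp))
    refine ⟨2 * K2 + 2 * K1, fun n => ?_⟩
    have a1 := h1 n
    have a2 := h2 n
    rw [cf_deriv2 n f hf2 hp, abs_mul, abs_neg, abs_of_nonneg (by positivity)] at a2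
    have : ((n : ℝ) + 1) ^ (2 * (j + 1)) ≤ ((n : ℝ) + 1) ^ (2 * j) * (2 * n ^ 2 + 2) := by
      rw [show 2 * (j + 1) = 2 * j + 2 by ring, pow_add]
      gcongr
      nlinarith [sq_nonneg ((n : ℝ) - 1)]
    calc |cf n f| * ((n : ℝ) + 1) ^ (2 * (j + 1)) ≤
        |cf n f| * (((n : ℝ) + 1) ^ (2 * j) * (2 * n ^ 2 + 2)) := by gcongr
      _ ≤ _ := by nlinarith

lemma contDiff_series (N : ℕ) (b : ℕ → ℝ)
    (hb : ∀ k : ℕ, k ≤ N → Summable fun n : ℕ => |b n| * (n : ℝ) ^ k) :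
    ContDiff ℝ (N : WithTop ℕ∞) (fun x : ℝ => ∑' n : ℕ, b n * cos (n * x)) := by
  have key := contDiff_tsum (𝕜 := ℝ) (N := (N : ℕ∞)) (f := fun (n : ℕ) (x : ℝ) => b n * cos (n * x))
    (v := fun k n => |b n| * (n : ℝ) ^ k) (fun i => by fun_prop)
    (fun k hk => hb k (by exact_mod_cast hk)) ?_
  · exact_mod_cast key
  · intro k n x _
    rw [norm_iteratedFDeriv_eq_norm_iteratedDeriv]
    have h1 : iteratedDeriv k (fun x : ℝ => b n * cos (n * x)) x
        = b n * ((n : ℝ) ^ k * iteratedDeriv k cos (n * x)) := by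
      rw [iteratedDeriv_const_mul_field, iteratedDeriv_comp_const_mul (by fun_prop)]
    rw [h1, Real.norm_eq_abs, abs_mul, abs_mul, abs_of_nonneg (a := (n : ℝ) ^ k) (by positivity)]
    have h2 := abs_iteratedDeriv_cos_le_one k (n * x)
    calc _ ≤ |b n| * ((n : ℝ) ^ k * 1) := by gcongr
      _ = _ := by ring

lemma deriv2_series (b : ℕ → ℝ)
    (hb : ∀ k : ℕ, k ≤ 2 → Summable fun n : ℕ => |b n| * (n : ℝ) ^ k) :
    deriv (deriv (fun x : ℝ => ∑' n : ℕ, b n * cos (n * x)))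
      = fun x : ℝ => ∑' n : ℕ, (-(n : ℝ) ^ 2 * b n) * cos (n * x) := by
  have dc : ∀ (n : ℕ) (x : ℝ), HasDerivAt (fun x : ℝ => cos (n * x)) (-(n * sin (n * x))) x := by
    intro n x
    have := ((hasDerivAt_id' x).const_mul (n : ℝ)).cos
    convert this using 1
    ring
  have ds : ∀ (n : ℕ) (x : ℝ), HasDerivAt (fun x : ℝ => sin (n * x)) (n * cos (n * x)) x := by
    intro n x
    have := ((hasDerivAt_id' x).const_mul (n : ℝ)).sin
    convert this using 1
    ring
  have h1 : deriv (fun x : ℝ => ∑' n : ℕ, b n * cos (n * x))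
      = fun x : ℝ => ∑' n : ℕ, b n * (-(n * sin (n * x))) := by
    ext x
    refine (hasDerivAt_tsum (hb 1 (by norm_num)) (fun n y => (dc n y).const_mul (b n)) ?_
      (y₀ := 0) ?_ x).deriv
    · intro n y
      rw [norm_mul, norm_neg, norm_mul, Real.norm_eq_abs, Real.norm_eq_abs, Real.norm_eq_abs,
        pow_one, Nat.abs_cast]
      have := abs_sin_le_one (n * y)
      calc _ ≤ |b n| * ((n : ℝ) * 1) := by gcongr
        _ = _ := by ring
    · have h0 := hb 0 (by norm_num)
      simp only [pow_zero, mul_one] at h0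
      simpa using h0.of_abs
  rw [h1]
  ext x
  refine ((hasDerivAt_tsum (hb 2 le_rfl)
    (fun n y => (((ds n y).const_mul (n : ℝ)).neg).const_mul (b n)) ?_ (y₀ := 0) ?_ x).deriv).trans ?_
  · intro n y
    rw [norm_mul, norm_neg, norm_mul, norm_mul, Real.norm_eq_abs, Real.norm_eq_abs,
      Real.norm_eq_abs, Nat.abs_cast]
    have := abs_cos_le_one (n * y)
    calc _ ≤ |b n| * ((n : ℝ) * (n * 1)) := by gcongr
      _ = _ := by ring
  · simp [summable_zero]
  · congr 1; ext n; ring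

lemma hasSum_cos (f : ℝ → ℝ) (hf : Continuous f) (hp : Function.Periodic f (2 * π))
    (he : ∀ x, f (-x) = f x) (hs : Summable fun n : ℕ => |cf n f|) (x : ℝ) :
    HasSum (fun n : ℕ => cf n f * cos (n * x)) (f x + cf 0 f / 2) := by
  have : Fact (0 < 2 * π) := ⟨by positivity⟩
  have hpc : Function.Periodic (fun x => (f x : ℂ)) (2 * π) := fun x => by simp [hp x]
  let F : C(AddCircle (2 * π), ℂ) := ⟨hpc.lift, by
    apply Continuous.quotient_lift
    fun_prop⟩
  have hF : ∀ x : ℝ, F (x : AddCircle (2 * π)) = f x := fun x => hpc.lift_coe x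
  have hfour : ∀ (m : ℤ) (x : ℝ), (fourier m (x : AddCircle (2 * π)) : ℂ)
      = cos (m * x) + sin (m * x) * Complex.I := by
    intro m x
    rw [fourier_coe_apply]
    have : 2 * (π : ℂ) * Complex.I * m * x / ((2 * π : ℝ) : ℂ) = ((m * x : ℝ) : ℂ) * Complex.I := by
      have : (π : ℂ) ≠ 0 := by exact_mod_cast pi_ne_zero
      push_cast
      field_simp
    rw [this, Complex.exp_mul_I, Complex.ofReal_cos, Complex.ofReal_sin]
  have hodd : ∀ m : ℤ, ∫ x in (-π)..π, f x * sin (m * x) = 0 := by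
    intro m
    have h1 := intervalIntegral.integral_comp_neg (a := -π) (b := π) (fun x => f x * sin (m * x))
    simp only [he, mul_neg, sin_neg, neg_neg, intervalIntegral.integral_neg] at h1
    linarith
  have hco : ∀ m : ℤ, fourierCoeff F m = ((cf m.natAbs f / 2 : ℝ) : ℂ) := by
    intro m
    rw [fourierCoeff_eq_intervalIntegral F m (-π)]
    rw [show -π + 2 * π = π by ring]
    have h1 : ∀ x : ℝ, (fourier (-m) (x : AddCircle (2 * π)) : ℂ) • F (x : AddCircle (2 * π))
        = ((f x * cos (m.natAbs * x) : ℝ) : ℂ) - ((f x * sin (m * x) : ℝ) : ℂ) * Complex.I := by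
      intro x
      have h3 : cos ((m.natAbs : ℝ) * x) = cos (m * x) := by
        rcases Int.natAbs_eq m with h | h
        · conv_rhs => rw [h]
          simp
        · conv_rhs => rw [h]
          simp
      rw [hfour, hF, h3]
      push_cast
      simp only [neg_mul, Complex.cos_neg, Complex.sin_neg, smul_eq_mul]
      ring
    simp_rw [h1]
    rw [intervalIntegral.integral_sub, intervalIntegral.integral_mul_const,
      intervalIntegral.integral_ofReal, intervalIntegral.integral_ofReal, hodd]
    · unfold cf
      have : (π : ℂ) ≠ 0 := by exact_mod_cast pi_ne_zero
      rw [Complex.real_smul]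
      push_cast
      field_simp
      ring
    · apply Continuous.intervalIntegrable; fun_prop
    · apply Continuous.intervalIntegrable; fun_prop
  have hsum : Summable (fourierCoeff F) := by
    have hs2 : Summable fun n : ℕ => ((cf n f / 2 : ℝ) : ℂ) := by
      apply Summable.of_norm
      simpa using hs.div_const 2
    apply Summable.of_nat_of_neg
    · simpa [hco] using hs2
    · simpa [hco] using hs2
  have key := has_pointwise_sum_fourier_series_of_summable hsum (x : AddCircle (2 * π))
  have key2 := key.nat_add_neg
  rw [hF] at key2
  have h4 : (fun n : ℕ => fourierCoeff F n • fourier (n : ℤ) (x : AddCircle (2 * π)) +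
      fourierCoeff F (-(n : ℤ)) • fourier (-(n : ℤ)) (x : AddCircle (2 * π)))
      = fun n : ℕ => ((cf n f * cos (n * x) : ℝ) : ℂ) := by
    ext n
    rw [hfour, hfour, hco, hco]
    push_cast
    simp only [neg_mul, Complex.cos_neg, Complex.sin_neg, smul_eq_mul, Int.natAbs_neg,
      Int.natAbs_natCast]
    ring
  rw [h4, hfour, hco] at key2
  have h5 : (f x : ℂ) + ((cf (0 : ℤ).natAbs f / 2 : ℝ) : ℂ) •
      (((cos (((0 : ℤ) : ℝ) * x) : ℝ) : ℂ) + ((sin (((0 : ℤ) : ℝ) * x) : ℝ) : ℂ) * Complex.I)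
      = ((f x + cf 0 f / 2 : ℝ) : ℂ) := by
    simp
  rw [h5] at key2
  exact_mod_cast key2

section abstractFP
variable {E : Type*} [NormedCommRing E] [NormedAlgebra ℝ E]

lemma cube_diff (e y z : E) (he : ‖e‖ ≤ 1) (hy : ‖y‖ ≤ 1 / 100) (hz : ‖z‖ ≤ 1 / 100) :
    ‖(e + y) ^ 3 - (e + z) ^ 3‖ ≤ 4 * ‖y - z‖ := by
  have h1 : (e + y) ^ 3 - (e + z) ^ 3
      = (y - z) * ((e + y) * (e + y) + (e + y) * (e + z) + (e + z) * (e + z)) := by ring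
  have hp : ‖e + y‖ ≤ 101 / 100 := (norm_add_le _ _).trans (by linarith)
  have hq : ‖e + z‖ ≤ 101 / 100 := (norm_add_le _ _).trans (by linarith)
  have m1 : ∀ p q : E, ‖p‖ ≤ 101 / 100 → ‖q‖ ≤ 101 / 100 → ‖p * q‖ ≤ 101 / 100 * (101 / 100) :=
    fun p q hp hq => (norm_mul_le p q).trans
      (mul_le_mul hp hq (norm_nonneg _) (by norm_num))
  have h2 : ‖(e + y) * (e + y) + (e + y) * (e + z) + (e + z) * (e + z)‖ ≤ 4 := by
    refine (norm_add₃_le).trans ?_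
    linarith [m1 _ _ hp hp, m1 _ _ hp hq, m1 _ _ hq hq]
  rw [h1]
  refine (norm_mul_le _ _).trans ?_
  nlinarith [norm_nonneg (y - z)]

lemma cube_norm (e z : E) (he : ‖e‖ ≤ 1) (hz : ‖z‖ ≤ 1 / 100) : ‖(e + z) ^ 3‖ ≤ 2 := by
  have hq : ‖e + z‖ ≤ 101 / 100 := (norm_add_le _ _).trans (by linarith)
  have h1 : (e + z) ^ 3 = (e + z) * ((e + z) * (e + z)) := by ring
  rw [h1]
  have h2 := norm_mul_le (e + z) ((e + z) * (e + z))
  have h3 := norm_mul_le (e + z) (e + z)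
  have h4 : ‖e + z‖ * ‖e + z‖ ≤ 101 / 100 * (101 / 100) :=
    mul_le_mul hq hq (norm_nonneg _) (by norm_num)
  have h5 : ‖e + z‖ * ‖(e + z) * (e + z)‖ ≤ 101 / 100 * (101 / 100 * (101 / 100)) :=
    mul_le_mul hq (h3.trans h4) (norm_nonneg _) (by norm_num)
  linarith

lemma c_lower (e z : E) (he : ‖e‖ ≤ 1) (hz : ‖z‖ ≤ 1 / 100) (c : E →L[ℝ] ℝ)
    (hc : ∀ f, |c f| ≤ 2 * ‖f‖) (hce : c (e ^ 3) = 3 / 4) : 1 / 2 ≤ c ((e + z) ^ 3) := by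
  have h1 := cube_diff e z 0 he hz (by simp)
  rw [add_zero, sub_zero] at h1
  have h2 := (hc ((e + z) ^ 3 - e ^ 3))
  rw [map_sub, hce] at h2
  have := abs_le.1 h2
  linarith [this.1]

lemma abstract_fp [CompleteSpace E] (e : E) (he : ‖e‖ ≤ 1) (c : E →L[ℝ] ℝ)
    (hc : ∀ f, |c f| ≤ 2 * ‖f‖) (hce : c (e ^ 3) = 3 / 4) (M : E →L[ℝ] E) (C : ℝ) (hC : 1 ≤ C)
    (hM : ∀ f, ‖M f‖ ≤ C * ‖f‖) (μ : ℝ) (hμ : 0 < μ) (hμC : μ * C ≤ 1 / 1000) :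
    ∃ z : E, ‖z‖ ≤ 1 / 100 ∧ z = (μ / c ((e + z) ^ 3)) • M ((e + z) ^ 3) ∧
      ∀ y : E, ‖y‖ ≤ 1 / 100 → y = (μ / c ((e + y) ^ 3)) • M ((e + y) ^ 3) → y = z := by
  set F : E → E := fun z => (μ / c ((e + z) ^ 3)) • M ((e + z) ^ 3) with hF
  have lip : ∀ y z : E, ‖y‖ ≤ 1 / 100 → ‖z‖ ≤ 1 / 100 → ‖F y - F z‖ ≤ 1 / 2 * ‖y - z‖ := by
    intro y z hy hz
    have cy := c_lower e y he hy c hc hce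
    have cz := c_lower e z he hz c hc hce
    have hd := cube_diff e y z he hy hz
    have hn := cube_norm e z he hz
    set p := (e + y) ^ 3
    set q := (e + z) ^ 3
    have h1 : F y - F z = (μ / c p) • M (p - q) + (μ * (c (q - p)) / (c p * c q)) • M q := by
      have e1 : μ * c (q - p) / (c p * c q) = μ / c p - μ / c q := by
        rw [map_sub]; field_simp
      rw [e1, map_sub, smul_sub, sub_smul]
      simp only [hF]
      abel
    have hcd : |c (q - p)| ≤ 8 * ‖y - z‖ := by
      have := hc (q - p)
      rw [norm_sub_rev] at this
      linarith
    have hMd : ‖M (p - q)‖ ≤ C * (4 * ‖y - z‖) := (hM _).trans (by gcongr)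
    have hMq : ‖M q‖ ≤ C * 2 := (hM _).trans (by gcongr)
    have s1 : |μ / c p| ≤ 2 * μ := by
      rw [abs_of_pos (by positivity), div_le_iff₀ (by linarith)]
      nlinarith
    have s2 : |μ * (c (q - p)) / (c p * c q)| ≤ 4 * μ * (8 * ‖y - z‖) := by
      rw [abs_div, abs_mul, abs_of_pos hμ, abs_of_pos (a := c p * c q) (by positivity),
        div_le_iff₀ (by positivity)]
      have : 1 / 4 ≤ c p * c q := by nlinarith
      have h0 : 0 ≤ μ * (8 * ‖y - z‖) := by positivity
      have h9 : μ * |c (q - p)| ≤ μ * (8 * ‖y - z‖) := by gcongr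
      nlinarith
    rw [h1]
    refine (norm_add_le _ _).trans ?_
    rw [norm_smul, norm_smul, Real.norm_eq_abs, Real.norm_eq_abs]
    have t1 : |μ / c p| * ‖M (p - q)‖ ≤ 2 * μ * (C * (4 * ‖y - z‖)) := by gcongr
    have t2 : |μ * (c (q - p)) / (c p * c q)| * ‖M q‖ ≤ 4 * μ * (8 * ‖y - z‖) * (C * 2) := by
      gcongr
    have t3 : 72 * (μ * C * ‖y - z‖) ≤ 72 * (1 / 1000 * ‖y - z‖) := by gcongr
    nlinarith [norm_nonneg (y - z)]
  have maps : Set.MapsTo F (Metric.closedBall 0 (1 / 100)) (Metric.closedBall 0 (1 / 100)) := by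
    intro z hz
    rw [mem_closedBall_zero_iff] at hz ⊢
    have cz := c_lower e z he hz c hc hce
    have hn := cube_norm e z he hz
    simp only [hF]
    rw [norm_smul, Real.norm_eq_abs]
    have s1 : |μ / c ((e + z) ^ 3)| ≤ 2 * μ := by
      rw [abs_of_pos (by positivity), div_le_iff₀ (by linarith)]
      nlinarith
    have hMq : ‖M ((e + z) ^ 3)‖ ≤ C * 2 := (hM _).trans (by gcongr)
    calc _ ≤ 2 * μ * (C * 2) := by gcongr
      _ ≤ _ := by nlinarith
  have contr : ContractingWith (1 / 2) (maps.restrict F _ _) := by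
    refine ⟨by norm_num, LipschitzWith.of_dist_le_mul fun y z => ?_⟩
    rw [Subtype.dist_eq, Subtype.dist_eq, dist_eq_norm, dist_eq_norm]
    have := lip y z (mem_closedBall_zero_iff.1 y.2) (mem_closedBall_zero_iff.1 z.2)
    simpa using this
  obtain ⟨z, hz, hfix, -⟩ := ContractingWith.exists_fixedPoint' (x := (0 : E))
    (Metric.isClosed_closedBall.isComplete) maps contr (by simp) (edist_ne_top _ _)
  rw [mem_closedBall_zero_iff] at hz
  refine ⟨z, hz, hfix.symm, fun y hy hfy => ?_⟩
  have h1 := lip y z hy hz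
  have h2 : F y = y := hfy.symm
  have h3 : F z = z := hfix
  rw [h2, h3] at h1
  have h4 : ‖y - z‖ = 0 := le_antisymm (by linarith [norm_nonneg (y - z)]) (norm_nonneg _)
  exact sub_eq_zero.1 (norm_eq_zero.1 h4)
end abstractFP

open scoped BoundedContinuousFunction

/-- The function `cos (n x)` as a bounded continuous function. -/
noncomputable def cosB (n : ℕ) : ℝ →ᵇ ℝ :=
  BoundedContinuousFunction.ofNormedAddCommGroup (fun x : ℝ => cos (n * x)) (by fun_prop) 1
    (fun x => abs_cos_le_one _)

lemma cosB_apply (n : ℕ) (x : ℝ) : cosB n x = cos (n * x) := rfl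

lemma cosB_norm (n : ℕ) : ‖cosB n‖ ≤ 1 :=
  BoundedContinuousFunction.norm_ofNormedAddCommGroup_le _ zero_le_one _

/-- The coefficient functional on bounded continuous functions. -/
noncomputable def cB (n : ℕ) : (ℝ →ᵇ ℝ) →L[ℝ] ℝ :=
  LinearMap.mkContinuous
    { toFun := fun f => cf n f
      map_add' := fun f g => cf_add n f g f.continuous g.continuous
      map_smul' := fun a f => cf_smul n a f } 2
    (fun f => cf_bound n f ‖f‖ fun x _ => f.norm_coe_le_norm x)

lemma cB_apply (n : ℕ) (f : ℝ →ᵇ ℝ) : cB n f = cf n f := rfl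

lemma cB_bound (n : ℕ) (f : ℝ →ᵇ ℝ) : |cB n f| ≤ 2 * ‖f‖ :=
  cf_bound n f ‖f‖ fun x _ => f.norm_coe_le_norm x

lemma cB_cos3 : cB 1 (cosB 1 ^ 3) = 3 / 4 := by
  rw [cB_apply, ← cf_cos3]
  congr 1
  ext x
  simp [cosB_apply]

lemma summable_w : Summable fun n : ℕ => 50 / ((n : ℝ) + 1) ^ 4 := by
  have := (summable_nat_add_iff 1).2 (Real.summable_one_div_nat_pow.2 (by norm_num : 1 < 4))
  refine (this.mul_left 50).congr fun n => ?_
  push_cast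
  ring



lemma exists_M_abs {E : Type*} [NormedAddCommGroup E] [NormedSpace ℝ E] [CompleteSpace E]
    (a w : ℕ → ℝ) (hw : Summable w) (c : ℕ → E →L[ℝ] ℝ) (e : ℕ → E) (he : ∀ n, ‖e n‖ ≤ 1)
    (hc : ∀ n f, |c n f| ≤ 2 * ‖f‖) (ha : ∀ n, |a n| * 2 ≤ w n) :
    ∃ M : E →L[ℝ] E, (∀ f, ‖M f‖ ≤ (1 + ∑' n, w n) * ‖f‖) ∧
      ∀ f, HasSum (fun n => (a n * c n f) • e n) (M f) := by
  have hb : ∀ n, ‖a n • (c n).smulRight (e n)‖ ≤ w n := by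
    intro n
    have hwn : 0 ≤ w n := le_trans (by positivity) (ha n)
    refine ContinuousLinearMap.opNorm_le_bound _ hwn fun f => ?_
    rw [_root_.smul_apply, ContinuousLinearMap.smulRight_apply,
      norm_smul, norm_smul, Real.norm_eq_abs, Real.norm_eq_abs]
    calc _ ≤ |a n| * (2 * ‖f‖ * 1) := by
          gcongr
          · exact hc n f
          · exact he n
      _ = |a n| * 2 * ‖f‖ := by ring
      _ ≤ _ := by gcongr; exact ha n
  have hs : Summable fun n => a n • (c n).smulRight (e n) := Summable.of_norm_bounded hw hb
  refine ⟨∑' n, a n • (c n).smulRight (e n), fun f => ?_, fun f => ?_⟩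
  · refine (ContinuousLinearMap.le_opNorm _ f).trans ?_
    gcongr
    have := tsum_of_norm_bounded hw.hasSum hb
    linarith
  · have h1 := (ContinuousLinearMap.apply ℝ E f).hasSum hs.hasSum
    convert h1 using 1
    · ext n
      simp [mul_smul]
    · rfl

lemma exists_M (a : ℕ → ℝ) (ha : ∀ n, |a n| ≤ 25 / ((n : ℝ) + 1) ^ 4) :
    ∃ M : (ℝ →ᵇ ℝ) →L[ℝ] (ℝ →ᵇ ℝ),
      (∀ f, ‖M f‖ ≤ (1 + ∑' n : ℕ, 50 / ((n : ℝ) + 1) ^ 4) * ‖f‖) ∧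
      ∀ (f : ℝ →ᵇ ℝ) (x : ℝ), HasSum (fun n : ℕ => a n * cf n f * cos (n * x)) (M f x) := by
  obtain ⟨M, h1, h2⟩ := exists_M_abs a (fun n : ℕ => 50 / ((n : ℝ) + 1) ^ 4) summable_w cB cosB
    cosB_norm cB_bound (fun n => by
      have := ha n
      calc |a n| * 2 ≤ 25 / ((n : ℝ) + 1) ^ 4 * 2 := by gcongr
        _ = _ := by ring)
  refine ⟨M, h1, fun f x => ?_⟩
  exact (BoundedContinuousFunction.evalCLM ℝ x).hasSum (h2 f)

/-- Symbol of the linear operator. -/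
noncomputable def lam (ε k : ℝ) (n : ℕ) : ℝ := ε ^ 2 - (1 - k ^ 2 * n ^ 2) ^ 2

/-- Coefficients of the partial inverse. -/
noncomputable def aco (ε k : ℝ) (n : ℕ) : ℝ :=
  if n = 1 then 0 else (if n = 0 then 1 / 2 else 1) / lam ε k n

lemma lam_lb (ε k : ℝ) (h0 : 0 < ε) (h1 : ε ≤ 1 / 10) (hk : 1 - ε < k ^ 2) (n : ℕ) (hn : n ≠ 1) :
    ((n : ℝ) + 1) ^ 4 / 25 ≤ - lam ε k n := by
  unfold lam
  rcases Nat.lt_or_ge n 2 with h | h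
  · have : n = 0 := by omega
    subst this
    norm_num
    nlinarith
  · have hn2 : (2 : ℝ) ≤ n := by exact_mod_cast h
    have a1 : 28 / 100 * ((n : ℝ) + 1) ^ 2 ≤ k ^ 2 * n ^ 2 - 1 := by nlinarith
    have a2 : (28 / 100 * ((n : ℝ) + 1) ^ 2) ^ 2 ≤ (k ^ 2 * n ^ 2 - 1) ^ 2 := by gcongr
    have a3 : (3 : ℝ) ^ 4 ≤ ((n : ℝ) + 1) ^ 4 := by gcongr; linarith
    nlinarith

lemma aco_bound (ε k : ℝ) (h0 : 0 < ε) (h1 : ε ≤ 1 / 10) (hk : 1 - ε < k ^ 2) (n : ℕ) :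
    |aco ε k n| ≤ 25 / ((n : ℝ) + 1) ^ 4 := by
  unfold aco
  split_ifs with h h2
  · simp; positivity
  all_goals
    have hl := lam_lb ε k h0 h1 hk n h
    have hp : 0 < ((n : ℝ) + 1) ^ 4 := by positivity
    rw [abs_div, abs_of_neg (a := lam ε k n) (by linarith), div_le_div_iff₀ (by linarith) hp]
    norm_num
    linarith

lemma lam_aco (ε k : ℝ) (h0 : 0 < ε) (h1 : ε ≤ 1 / 10) (hk : 1 - ε < k ^ 2) (n : ℕ) :
    lam ε k n * aco ε k n = 1 - (if n = 1 then 1 else 0) - (if n = 0 then 1 / 2 else 0) := by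
  unfold aco
  by_cases h : n = 1
  · simp [h]
  · have hl := lam_lb ε k h0 h1 hk n h
    have hp : 0 < ((n : ℝ) + 1) ^ 4 := by positivity
    have hne : lam ε k n ≠ 0 := by linarith
    by_cases h2 : n = 0
    · subst h2; simp; field_simp; norm_num
    · simp [h, h2]; field_simp

lemma my_hasSum_congr {f g : ℕ → ℝ} {a : ℝ} (h : ∀ n, f n = g n) (hg : HasSum g a) :
    HasSum f a := by
  rw [show f = g from funext h]; exact hg

lemma iter2 (f : ℝ → ℝ) : iteratedDeriv 2 f = deriv (deriv f) := by
  simp [iteratedDeriv_succ]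

lemma iter4 (f : ℝ → ℝ) : iteratedDeriv 4 f = deriv (deriv (deriv (deriv f))) := by
  simp [iteratedDeriv_succ]

lemma series_ode (ε k : ℝ) (b : ℕ → ℝ)
    (hb : ∀ m : ℕ, m ≤ 4 → Summable fun n : ℕ => |b n| * (n : ℝ) ^ m) (x : ℝ)
    (z : ℝ → ℝ) (hz : z = fun x : ℝ => ∑' n : ℕ, b n * cos (n * x)) :
    HasSum (fun n : ℕ => lam ε k n * b n * cos (n * x))
      (ε ^ 2 * z x - (z x + 2 * k ^ 2 * iteratedDeriv 2 z x + k ^ 4 * iteratedDeriv 4 z x)) := by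
  have d2 := deriv2_series b (fun m hm => hb m (by omega))
  rw [← hz] at d2
  have hb2 : ∀ m : ℕ, m ≤ 2 → Summable fun n : ℕ => |-(n : ℝ) ^ 2 * b n| * (n : ℝ) ^ m := by
    intro m hm
    refine (hb (m + 2) (by omega)).congr fun n => ?_
    rw [abs_mul, abs_neg, abs_of_nonneg (a := (n : ℝ) ^ 2) (by positivity)]
    ring
  have d4 := deriv2_series _ hb2
  have e2 : iteratedDeriv 2 z = fun x : ℝ => ∑' n : ℕ, (-(n : ℝ) ^ 2 * b n) * cos (n * x) := by
    exact (iter2 z).trans d2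
  have e4 : iteratedDeriv 4 z
      = fun x : ℝ => ∑' n : ℕ, (-(n : ℝ) ^ 2 * (-(n : ℝ) ^ 2 * b n)) * cos (n * x) := by
    refine (iter4 z).trans ?_
    rw [show deriv (deriv z) = _ from d2]
    exact d4
  have sm : ∀ c : ℕ → ℝ, (Summable fun n => |c n|) → Summable fun n : ℕ => c n * cos (n * x) := by
    intro c hc
    refine Summable.of_norm_bounded hc fun n => ?_
    rw [norm_mul, Real.norm_eq_abs, Real.norm_eq_abs]
    have := abs_cos_le_one (n * x)
    nlinarith [abs_nonneg (c n)]
  have s0 := (sm b (by simpa using hb 0 (by norm_num))).hasSum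
  have s2 := (sm (fun n => -(n : ℝ) ^ 2 * b n) (by
    refine (hb 2 (by norm_num)).congr fun n => ?_
    rw [abs_mul, abs_neg, abs_of_nonneg (a := (n : ℝ) ^ 2) (by positivity)]
    ring)).hasSum
  have s4 := (sm (fun n => -(n : ℝ) ^ 2 * (-(n : ℝ) ^ 2 * b n)) (by
    refine (hb 4 (by norm_num)).congr fun n => ?_
    rw [abs_mul, abs_mul, abs_neg, abs_of_nonneg (a := (n : ℝ) ^ 2) (by positivity)]
    ring)).hasSum
  rw [e2, e4, show z x = _ from congrFun hz x]
  refine my_hasSum_congr (fun n => ?_) ((s0.mul_left (ε ^ 2)).sub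
    ((s0.add (s2.mul_left (2 * k ^ 2))).add (s4.mul_left (k ^ 4))))
  unfold lam
  ring

lemma summable_b (ε k : ℝ) (h0 : 0 < ε) (h1 : ε ≤ 1 / 10) (hk : 1 - ε < k ^ 2) (s K : ℝ) (j : ℕ)
    (f : ℝ → ℝ) (hK : ∀ n : ℕ, |cf n f| * ((n : ℝ) + 1) ^ (2 * j) ≤ K) (m : ℕ)
    (hm : m ≤ 2 * j + 2) :
    Summable fun n : ℕ => |s * (aco ε k n * cf n f)| * (n : ℝ) ^ m := by
  have hw : Summable fun n : ℕ => |s| * (25 * K) * (1 / ((n : ℝ) + 1) ^ 2) := by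
    have := (summable_nat_add_iff 1).2 (Real.summable_one_div_nat_pow.2 (by norm_num : 1 < 2))
    refine (this.mul_left (|s| * (25 * K))).congr fun n => ?_
    push_cast
    rfl
  refine Summable.of_nonneg_of_le (fun n => by positivity) (fun n => ?_) hw
  have ha := aco_bound ε k h0 h1 hk n
  have hn : (1 : ℝ) ≤ (n : ℝ) + 1 := by linarith [(Nat.cast_nonneg n : (0 : ℝ) ≤ n)]
  have hnm : (n : ℝ) ^ m ≤ ((n : ℝ) + 1) ^ (2 * j + 2) :=
    (pow_le_pow_left₀ (by positivity) (by linarith) m).trans (pow_le_pow_right₀ hn hm)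
  rw [abs_mul, abs_mul]
  calc |s| * (|aco ε k n| * |cf n f|) * (n : ℝ) ^ m
      ≤ |s| * (25 / ((n : ℝ) + 1) ^ 4 * |cf n f|) * ((n : ℝ) + 1) ^ (2 * j + 2) := by gcongr
    _ = |s| * (25 * (|cf n f| * ((n : ℝ) + 1) ^ (2 * j))) * (1 / ((n : ℝ) + 1) ^ 2) := by
      rw [pow_add]; field_simp
    _ ≤ _ := by gcongr; exact hK n

lemma exist_part (ε k : ℝ) (h0 : 0 < ε) (h1 : ε ≤ 1 / 10) (hk : 1 - ε < k ^ 2) (s A : ℝ)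
    (hA : A ^ 2 = s) (z f : ℝ → ℝ) (hzc : Continuous z) (hf : f = fun x => (cos x + z x) ^ 3)
    (hz : ∀ x, HasSum (fun n : ℕ => s * (aco ε k n * cf n f) * cos (n * x)) (z x))
    (hs : s * cf 1 f = lam ε k 1) :
    ContDiff ℝ (⊤ : ℕ∞) (fun x => A * (cos x + z x)) ∧
    Function.Periodic (fun x => A * (cos x + z x)) (2 * π) ∧
    (∀ x, A * (cos (-x) + z (-x)) = A * (cos x + z x)) ∧
    SwiftHohenberg1D ε k (fun x => A * (cos x + z x)) := by
  have hz' : z = fun x : ℝ => ∑' n : ℕ, (s * (aco ε k n * cf n f)) * cos (n * x) := by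
    ext x; exact (hz x).tsum_eq.symm
  have hzp : Function.Periodic z (2 * π) := by
    intro x
    rw [hz']
    simp only []
    congr 1; ext n
    rw [mul_add, cos_add_nat_mul_two_pi]
  have hze : ∀ x, z (-x) = z x := by
    intro x
    rw [hz']
    simp only [mul_neg, cos_neg]
  have hfp : Function.Periodic f (2 * π) := by
    intro x
    rw [hf]
    simp only [hzp x, cos_add_two_pi]
  have hfe : ∀ x, f (-x) = f x := by
    intro x
    rw [hf]
    simp only [hze x, cos_neg]
  have smooth : ∀ j : ℕ, ContDiff ℝ ((2 * j : ℕ) : WithTop ℕ∞) z := by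
    intro j
    induction j with
    | zero => simpa using hzc
    | succ j ih =>
      have hfs : ContDiff ℝ ((2 * j : ℕ) : WithTop ℕ∞) f := by
        rw [hf]; exact (contDiff_cos.add ih).pow 3
      obtain ⟨K, hK⟩ := cf_decay j f hfs hfp
      rw [hz']
      exact contDiff_series (2 * (j + 1)) _
        (fun m hm => summable_b ε k h0 h1 hk s K j f hK m (by omega))
  have hsm : ContDiff ℝ (⊤ : ℕ∞) z := by
    rw [contDiff_infty]
    intro n
    exact (smooth n).of_le (by
      have : n ≤ 2 * n := by omega
      exact_mod_cast this)
  have hfsm : ∀ j : ℕ, ContDiff ℝ ((2 * j : ℕ) : WithTop ℕ∞) f := by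
    intro j
    rw [hf]; exact (contDiff_cos.add (smooth j)).pow 3
  have ode : ∀ x, ε ^ 2 * z x - (z x + 2 * k ^ 2 * iteratedDeriv 2 z x
      + k ^ 4 * iteratedDeriv 4 z x) = s * f x - lam ε k 1 * cos x := by
    intro x
    obtain ⟨K, hK⟩ := cf_decay 1 f (hfsm 1) hfp
    have e1 := series_ode ε k (fun n => s * (aco ε k n * cf n f))
      (fun m hm => summable_b ε k h0 h1 hk s K 1 f hK m (by omega)) x z hz'
    have hsc : Summable fun n : ℕ => |cf n f| := by
      have := (summable_nat_add_iff 1).2 (Real.summable_one_div_nat_pow.2 (by norm_num : 1 < 2))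
      refine Summable.of_nonneg_of_le (fun n => abs_nonneg _) (fun n => ?_) (this.mul_left K)
      have hp : 0 < ((n : ℝ) + 1) ^ 2 := by positivity
      push_cast
      rw [mul_one_div, le_div_iff₀ hp]
      exact hK n
    have e2 := hasSum_cos f (hfsm 0).continuous hfp hfe hsc x
    have e3 := hasSum_ite_eq (1 : ℕ) (s * cf 1 f * cos x)
    have e4 := hasSum_ite_eq (0 : ℕ) (s * (cf 0 f / 2))
    have e5 := ((e2.mul_left s).sub e3).sub e4
    rw [hs] at e5
    have e6 : (fun n : ℕ => lam ε k n * (s * (aco ε k n * cf n f)) * cos (n * x))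
        = fun n : ℕ => s * (cf n f * cos (n * x)) - (if n = 1 then lam ε k 1 * cos x else 0)
          - (if n = 0 then s * (cf 0 f / 2) else 0) := by
      ext n
      have l1 := lam_aco ε k h0 h1 hk n
      have l2 : lam ε k n * (s * (aco ε k n * cf n f)) * cos (n * x)
        = (lam ε k n * aco ε k n) * (s * cf n f * cos (n * x)) := by ring
      rw [l2, l1]
      by_cases hn1 : n = 1
      · subst hn1; simp [← hs]; ring
      · by_cases hn0 : n = 0
        · subst hn0; simp; ring
        · simp [hn1, hn0]; ring
    rw [e6] at e1
    rw [e1.unique e5]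
    ring
  refine ⟨?_, ?_, ?_, ?_⟩
  · exact contDiff_const.mul (contDiff_cos.add hsm)
  · intro x
    simp only [hzp x, cos_add_two_pi]
  · intro x
    rw [hze, cos_neg]
  · intro x
    have it : ∀ m : ℕ, iteratedDeriv m (fun x => A * (cos x + z x)) x
        = A * (iteratedDeriv m cos x + iteratedDeriv m z x) := by
      intro m
      rw [iteratedDeriv_const_mul_field, iteratedDeriv_fun_add]
      · exact contDiff_cos.contDiffAt
      · exact (hsm.of_le (by exact_mod_cast le_top)).contDiffAt
    have o := ode x
    have c2 : iteratedDeriv 2 cos x = - cos x := by simp [iteratedDeriv_succ]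
    have c4 : iteratedDeriv 4 cos x = cos x := by simp [iteratedDeriv_succ]
    rw [it, it, c2, c4]
    have hfx : f x = (cos x + z x) ^ 3 := by rw [hf]
    rw [hfx] at o
    unfold lam at o
    push_cast at o
    subst hA
    linear_combination A * o

lemma uniq_part (ε k : ℝ) (h0 : 0 < ε) (h1 : ε ≤ 1 / 10) (hk : 1 - ε < k ^ 2) (w : ℝ → ℝ)
    (hw : ContDiff ℝ 4 w) (hp : Function.Periodic w (2 * π)) (he : ∀ x, w (-x) = w x)
    (hS : SwiftHohenberg1D ε k w) :
    lam ε k 1 * cf 1 w = cf 1 (fun x => w x ^ 3) ∧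
    ∀ x, HasSum (fun n : ℕ => aco ε k n * cf n (fun x => w x ^ 3) * cos (n * x))
      (w x - cf 1 w * cos x) := by
  have hw1 : ContDiff ℝ 3 (deriv w) := ContDiff.deriv' (hw.of_le (by norm_num))
  have hw2 : ContDiff ℝ 2 (deriv (deriv w)) := ContDiff.deriv' (hw1.of_le (by norm_num))
  have hw3 : ContDiff ℝ 1 (deriv (deriv (deriv w))) := ContDiff.deriv' (hw2.of_le (by norm_num))
  have hw4 : Continuous (deriv (deriv (deriv (deriv w)))) := hw3.continuous_deriv (by norm_num)
  have c0 := hw.continuous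
  have c2 := hw2.continuous
  have h2w : ContDiff ℝ 2 w := hw.of_le (by norm_num)
  have key : ∀ n, lam ε k n * cf n w = cf n (fun x => w x ^ 3) := by
    intro n
    have e1 : (fun x => w x ^ 3) = fun x => ((ε ^ 2 - 1) * w x
        + (-(2 * k ^ 2)) * deriv (deriv w) x) + (-k ^ 4) * deriv (deriv (deriv (deriv w))) x := by
      ext x
      have := hS x
      rw [iter2, iter4] at this
      linarith
    rw [e1, cf_add n _ _ (by fun_prop) (by fun_prop), cf_add n _ _ (by fun_prop) (by fun_prop),
      cf_smul, cf_smul, cf_smul,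
      cf_deriv2 n _ hw2 (periodic_deriv _ _ (periodic_deriv _ _ hp)), cf_deriv2 n w h2w hp]
    unfold lam
    ring
  refine ⟨key 1, fun x => ?_⟩
  obtain ⟨K, hK⟩ := cf_decay 1 w (by exact_mod_cast h2w) hp
  have hsc : Summable fun n : ℕ => |cf n w| := by
    have := (summable_nat_add_iff 1).2 (Real.summable_one_div_nat_pow.2 (by norm_num : 1 < 2))
    refine Summable.of_nonneg_of_le (fun n => abs_nonneg _) (fun n => ?_) (this.mul_left K)
    have hp : 0 < ((n : ℝ) + 1) ^ 2 := by positivity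
    push_cast
    rw [mul_one_div, le_div_iff₀ hp]
    exact hK n
  have e2 := hasSum_cos w c0 hp he hsc x
  have e3 := hasSum_ite_eq (1 : ℕ) (cf 1 w * cos x)
  have e4 := hasSum_ite_eq (0 : ℕ) (cf 0 w / 2)
  rw [show w x - cf 1 w * cos x = w x + cf 0 w / 2 - cf 1 w * cos x - cf 0 w / 2 by ring]
  refine my_hasSum_congr (fun n => ?_) ((e2.sub e3).sub e4)
  rw [← key n]
  have l1 := lam_aco ε k h0 h1 hk n
  have l2 : aco ε k n * (lam ε k n * cf n w) * cos (n * x)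
      = (lam ε k n * aco ε k n) * (cf n w * cos (n * x)) := by ring
  rw [l2, l1]
  by_cases hn1 : n = 1
  · subst hn1; simp
  · by_cases hn0 : n = 0
    · subst hn0; simp; ring
    · simp [hn1, hn0]

theorem roll_existence_uniqueness :
    ∃ ε₀ : ℝ, 0 < ε₀ ∧ ε₀ < 1 ∧
      ∀ ε : ℝ, 0 < ε → ε < ε₀ →
        ∀ k : ℝ, Real.sqrt (1 - ε) < k → k < Real.sqrt (1 + ε) →
          ∃ u_p : ℝ → ℝ,
            ContDiff ℝ (⊤ : ℕ∞) u_p ∧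
            Function.Periodic u_p (2 * π) ∧
            (∀ ξ : ℝ, u_p (-ξ) = u_p ξ) ∧
            0 < u_p 0 ∧
            (∀ ξ : ℝ, |u_p ξ| ≤ 2 * ε) ∧
            (∀ ξ : ℝ, u_p (ξ + π) = -u_p ξ) ∧
            SwiftHohenberg1D ε k u_p ∧
            (∀ w : ℝ → ℝ, ContDiff ℝ 4 w → Function.Periodic w (2 * π) →
              (∀ ξ : ℝ, w (-ξ) = w ξ) → 0 < w 0 → (∀ ξ : ℝ, |w ξ| ≤ 2 * ε) →
              SwiftHohenberg1D ε k w → w = u_p) := by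
  set C : ℝ := 1 + ∑' n : ℕ, 50 / ((n : ℝ) + 1) ^ 4 with hCdef
  have hC : 1 ≤ C := by
    have : 0 ≤ ∑' n : ℕ, 50 / ((n : ℝ) + 1) ^ 4 := tsum_nonneg fun n => by positivity
    linarith
  refine ⟨1 / (1000 * C), by positivity, ?_, ?_⟩
  · rw [div_lt_one (by positivity)]; linarith
  intro ε h0 hε k hk1 hk2
  have hεC : ε * C < 1 / 1000 := by
    rw [lt_div_iff₀ (by positivity)] at hε
    linarith
  have h1 : ε ≤ 1 / 1000 := by nlinarith
  have h1' : ε ≤ 1 / 10 := by linarith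
  have hk : 1 - ε < k ^ 2 := by
    rw [Real.sqrt_lt' (lt_of_le_of_lt (Real.sqrt_nonneg _) hk1)] at hk1
    exact hk1
  have hk' : k ^ 2 < 1 + ε := by
    have hkp : 0 ≤ k := (lt_of_le_of_lt (Real.sqrt_nonneg _) hk1).le
    rwa [Real.lt_sqrt hkp] at hk2
  set μ : ℝ := lam ε k 1 with hμdef
  have hμv : μ = ε ^ 2 - (1 - k ^ 2) ^ 2 := by simp [hμdef, lam]
  have hμ : 0 < μ := by rw [hμv]; nlinarith
  have hμle : μ ≤ ε ^ 2 := by rw [hμv]; nlinarith [sq_nonneg (1 - k ^ 2)]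
  have hε2C : ε ^ 2 * C ≤ 1 / 1000 * (1 / 1000) := by nlinarith
  have hμC : μ * C ≤ 1 / 1000 := by nlinarith
  obtain ⟨M, hM, hMs⟩ := exists_M (aco ε k) (aco_bound ε k h0 h1' hk)
  rw [← hCdef] at hM
  obtain ⟨z, hz, hzfix, hzu⟩ := abstract_fp (cosB 1) (cosB_norm 1) (cB 1) (cB_bound 1) cB_cos3
    M C hC hM μ hμ hμC
  have hcz := c_lower (cosB 1) z (cosB_norm 1) hz (cB 1) (cB_bound 1) cB_cos3
  set s : ℝ := μ / cB 1 ((cosB 1 + z) ^ 3) with hsdef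
  have hs : 0 < s := by positivity
  have hsle : s ≤ 2 * ε ^ 2 := by
    rw [hsdef, div_le_iff₀ (by linarith)]
    nlinarith
  set A : ℝ := √s with hAdef
  have hA : 0 < A := Real.sqrt_pos.2 hs
  have hA2 : A ^ 2 = s := Real.sq_sqrt hs.le
  have hAle : A ≤ 3 / 2 * ε := by
    apply Real.sqrt_le_iff.2
    constructor
    · positivity
    · nlinarith
  have hzx : ∀ x, |z x| ≤ 1 / 100 := fun x => (z.norm_coe_le_norm x).trans hz
  have hcf : (fun x => (cos x + z x) ^ 3) = ((cosB 1 + z) ^ 3 : ℝ →ᵇ ℝ) := by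
    ext x; simp [cosB_apply]
  obtain ⟨p1, p2, p3, p4⟩ := exist_part ε k h0 h1' hk s A hA2 z (fun x => (cos x + z x) ^ 3)
    z.continuous rfl (by
      intro x
      have h := (hMs ((cosB 1 + z) ^ 3) x).mul_left s
      rw [hcf]
      have hx : z x = s * M ((cosB 1 + z) ^ 3) x := by
        conv_lhs => rw [hzfix]
        rfl
      rw [hx]
      refine my_hasSum_congr (fun n => ?_) h
      ring) (by
      rw [hcf, ← cB_apply, hsdef]
      field_simp
      try exact hμdef)
  have huniq : ∀ w : ℝ → ℝ, ContDiff ℝ 4 w → Function.Periodic w (2 * π) →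
      (∀ ξ : ℝ, w (-ξ) = w ξ) → 0 < w 0 → (∀ ξ : ℝ, |w ξ| ≤ 2 * ε) →
      SwiftHohenberg1D ε k w → w = fun x => A * (cos x + z x) := by
    intro w hw hp he hw0 hwb hS
    obtain ⟨q1, q2⟩ := uniq_part ε k h0 h1' hk w hw hp he hS
    let W : ℝ →ᵇ ℝ := BoundedContinuousFunction.ofNormedAddCommGroup w hw.continuous (2 * ε) hwb
    have hWn : ‖W‖ ≤ 2 * ε :=
      BoundedContinuousFunction.norm_ofNormedAddCommGroup_le _ (by positivity) _
    have hWx : ∀ x, W x = w x := fun x => rfl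
    have hW3 : (fun x => w x ^ 3) = ((W ^ 3 : ℝ →ᵇ ℝ) : ℝ → ℝ) := by
      ext x; simp [hWx]
    rw [hW3] at q1 q2
    set B : ℝ := cf 1 w with hB
    have hMW : ∀ x, M (W ^ 3) x = w x - B * cos x := fun x => (hMs (W ^ 3) x).unique (q2 x)
    have hdec : W = B • cosB 1 + M (W ^ 3) := by
      ext x
      have := hMW x
      simp only [BoundedContinuousFunction.coe_add, Pi.add_apply,
        BoundedContinuousFunction.coe_smul, smul_eq_mul, this, hWx, cosB_apply]
      simp
    have hW3n : ‖W ^ 3‖ ≤ 4 * ε ^ 2 * ‖W‖ := by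
      have e1 : W ^ 3 = W * (W * W) := by ring
      rw [e1]
      have n1 := norm_mul_le W (W * W)
      have n2 := norm_mul_le W W
      have n3 : ‖W‖ * ‖W‖ ≤ 2 * ε * (2 * ε) := mul_le_mul hWn hWn (norm_nonneg _) (by positivity)
      have n4 : ‖W‖ * ‖W * W‖ ≤ ‖W‖ * (2 * ε * (2 * ε)) := by
        gcongr
        exact n2.trans n3
      linarith
    have hMn : ‖M (W ^ 3)‖ ≤ 4 / 1000 * ‖W‖ := by
      calc _ ≤ C * (4 * ε ^ 2 * ‖W‖) := (hM _).trans (by gcongr)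
        _ = 4 * (ε ^ 2 * C) * ‖W‖ := by ring
        _ ≤ _ := by gcongr; linarith
    have hBn : ‖W‖ ≤ |B| + 4 / 1000 * ‖W‖ := by
      calc ‖W‖ = ‖B • cosB 1 + M (W ^ 3)‖ := by rw [← hdec]
        _ ≤ ‖B • cosB 1‖ + ‖M (W ^ 3)‖ := norm_add_le _ _
        _ ≤ |B| * 1 + 4 / 1000 * ‖W‖ := by
          rw [norm_smul, Real.norm_eq_abs]
          gcongr
          exact cosB_norm 1
        _ = _ := by ring
    have hMn2 : ‖M (W ^ 3)‖ ≤ 1 / 100 * |B| := by linarith [abs_nonneg B, norm_nonneg W]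
    have hM0 : |M (W ^ 3) 0| ≤ 1 / 100 * |B| :=
      ((M (W ^ 3)).norm_coe_le_norm 0).trans hMn2
    rw [hMW 0, cos_zero, mul_one] at hM0
    have hBpos : 0 < B := by
      by_contra hneg
      rw [abs_of_nonpos (a := B) (by linarith)] at hM0
      have := (abs_le.1 hM0).2
      linarith
    rw [abs_of_pos hBpos] at hMn2
    set y : ℝ →ᵇ ℝ := B⁻¹ • M (W ^ 3) with hy
    have hyn : ‖y‖ ≤ 1 / 100 := by
      rw [hy, norm_smul, norm_inv, Real.norm_eq_abs, abs_of_pos hBpos,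
        inv_mul_le_iff₀ hBpos]
      linarith
    have hWy : W = B • (cosB 1 + y) := by
      rw [smul_add, hy, smul_smul, mul_inv_cancel₀ hBpos.ne', one_smul]
      exact hdec
    have hcy := c_lower (cosB 1) y (cosB_norm 1) hyn (cB 1) (cB_bound 1) cB_cos3
    have hW3y : W ^ 3 = B ^ 3 • (cosB 1 + y) ^ 3 := by rw [hWy, smul_pow]
    have hB2 : B ^ 2 = μ / cB 1 ((cosB 1 + y) ^ 3) := by
      rw [← cB_apply, hW3y, map_smul, smul_eq_mul] at q1
      rw [eq_div_iff (by linarith)]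
      have : B * (B ^ 2 * cB 1 ((cosB 1 + y) ^ 3)) = B * μ := by linarith
      exact mul_left_cancel₀ hBpos.ne' this
    have hyfix : y = (μ / cB 1 ((cosB 1 + y) ^ 3)) • M ((cosB 1 + y) ^ 3) := by
      rw [← hB2]
      conv_lhs => rw [hy, hW3y, map_smul, smul_smul]
      congr 1
      field_simp
    have hyz := hzu y hyn hyfix
    have hBA : B = A := by
      rw [hyz, ← hsdef, ← hA2] at hB2
      exact (pow_left_inj₀ hBpos.le hA.le (by norm_num)).1 hB2
    ext x
    rw [← hWx, hWy, hyz, hBA]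
    simp [cosB_apply]
    ring
  have hbd : ∀ ξ : ℝ, |A * (cos ξ + z ξ)| ≤ 2 * ε := by
    intro ξ
    rw [abs_mul, abs_of_pos hA]
    have h2 : |cos ξ + z ξ| ≤ 101 / 100 :=
      (abs_add_le _ _).trans (by linarith [abs_cos_le_one ξ, hzx ξ])
    calc _ ≤ 3 / 2 * ε * (101 / 100) := by gcongr
      _ ≤ _ := by linarith
  refine ⟨fun x => A * (cos x + z x), p1, p2, p3, ?_, hbd, ?_, p4, huniq⟩
  · have := (abs_le.1 (hzx 0)).1
    simp only [cos_zero]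
    exact mul_pos hA (by linarith)
  · set u : ℝ → ℝ := fun x => A * (cos x + z x) with hu
    have h4 : ContDiff ℝ 4 u := by exact_mod_cast contDiff_infty.1 p1 4
    have hw := huniq (fun x => - u (x + π))
      ((h4.comp (contDiff_id.add contDiff_const)).neg)
      (fun x => by
        have := p2 (x + π)
        simp only [] at this ⊢
        rw [← this]; ring_nf)
      (fun x => by
        have a1 := p3 (x - π)
        have a2 := p2 (x - π)
        have a3 : u (-(x - π)) = u (x - π) := a1
        rw [show -x + π = -(x - π) by ring, a3, ← a2]
        ring_nf)
      (by
        have := (abs_le.1 (hzx π)).2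
        simp only [hu, zero_add, cos_pi]
        nlinarith)
      (fun x => by rw [abs_neg]; exact hbd _)
      (by
        intro x
        have it : ∀ m : ℕ, iteratedDeriv m (fun x => - u (x + π)) x
            = - iteratedDeriv m u (x + π) := by
          intro m
          rw [iteratedDeriv_fun_neg, iteratedDeriv_comp_add_const]
        rw [it, it]
        have := p4 (x + π)
        linear_combination - this)
    intro ξ
    have h9 : -u (ξ + π) = u ξ := congrFun hw ξ
    linarith
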